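/- For every composition s = (s(1),…,s(a)), the map sending a planar rooted tree T with signature s to the sequence μ = (μ(1),…,μ(a)), where the preorder word of T (writing N for each internal node and E for each leaf) equals N E^{μ(1)} N E^{μ(2)} ⋯ N E^{μ(a)} E, is a bijection from the set of s-trees onto the set of s-Dyck paths. -/

import Mathlib

/-- A planar rooted tree: a root together with a (possibly empty) ordered list of subtrees. -/
inductive PTree : Type where
  | node : List PTree → PTree

namespace PTree

/-- The signature of a planar rooted tree: the numbers of children of its internal
nodes, listed in preorder. -/
def signature : PTree → List ℕ
  | node [] => []
  | node (t :: ts) =>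
    (t :: ts).length :: ((t :: ts).attach.map (fun x => signature x.1)).flatten
decreasing_by
  have := List.sizeOf_lt_of_mem x.2
  simp at this ⊢
  omega

/-- The preorder word of a planar rooted tree: `true` (= N) for each internal node and
`false` (= E) for each leaf, nodes listed in preorder. -/
def word : PTree → List Bool
  | node ts => (!ts.isEmpty) :: (ts.attach.map (fun x => word x.1)).flatten
decreasing_by
  have := List.sizeOf_lt_of_mem x.2
  simp at this ⊢
  omega

end PTree

/-- The word `N E^{μ(1)} N E^{μ(2)} ⋯ N E^{μ(a)} E` encoded by the sequence `μ`. -/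
def pathWord (μ : List ℕ) : List Bool :=
  (μ.map (fun m => true :: List.replicate m false)).flatten ++ [false]

/-- `μ` encodes an `s`-Dyck path: it has length `a = ℓ(s)`, sum `|s| - a`, and its
partial sums are bounded by those of `s - 𝟏`. -/
def IsDyck (s μ : List ℕ) : Prop :=
  μ.length = s.length ∧ μ.sum + s.length = s.sum ∧
    ∀ i ≤ s.length, (μ.take i).sum ≤ ((s.take i).map (fun x => x - 1)).sum

namespace PTree

theorem signature_node_of_ne_nil {ts : List PTree} (h : ts ≠ []) :
    signature (node ts) = ts.length :: ts.flatMap signature := by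
  cases ts with
  | nil => exact absurd rfl h
  | cons t ts => rw [signature, List.attach_map_val (f := signature), List.flatMap_def]

theorem signature_leaf : signature (node []) = [] := by
  rw [signature]

theorem word_node (ts : List PTree) :
    word (node ts) = (!ts.isEmpty) :: ts.flatMap word := by
  rw [word, List.attach_map_val (f := word), List.flatMap_def]

/-- A planar forest is determined by its preorder word and its signature. -/
theorem forest_ext (w : List Bool) : ∀ F G : List PTree,
    F.flatMap word = w → G.flatMap word = w →
    F.flatMap signature = G.flatMap signature → F = G := by
  induction w with
  | nil =>
    intro F G hF hG _
    rcases F with _ | ⟨⟨ts⟩, F⟩ <;> rcases G with _ | ⟨⟨us⟩, G⟩ <;> simp_all [word_node]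
  | cons b w ih =>
    intro F G hF hG h
    rcases F with _ | ⟨⟨ts⟩, F⟩
    · simp at hF
    rcases G with _ | ⟨⟨us⟩, G⟩
    · simp at hG
    simp only [List.flatMap_cons, word_node, List.cons_append, List.cons.injEq] at hF hG
    have key := ih (ts ++ F) (us ++ G) (by simpa using hF.2) (by simpa using hG.2)
    have he : ts.isEmpty = us.isEmpty := by
      have := hF.1.trans hG.1.symm
      simpa using this
    by_cases hts : ts = []
    · have hus : us = [] := by simpa [hts] using he
      subst hts hus
      simp only [List.flatMap_cons, signature_leaf, List.nil_append] at h key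
      rw [key h]
    · have hus : us ≠ [] := by
        rintro rfl
        simp [hts] at he
      simp only [List.flatMap_cons, signature_node_of_ne_nil hts, signature_node_of_ne_nil hus,
        List.cons_append, List.cons.injEq] at h
      obtain ⟨rfl, rfl⟩ := List.append_inj (key (by simpa using h.2)) h.1
      rfl

end PTree

/-- `Decodes k s w`: reading the word `w` in preorder completes a forest of `k` pending trees,
the successive internal nodes having the arities listed in `s`. -/
inductive Decodes : ℕ → List ℕ → List Bool → Prop where
  | nil : Decodes 0 [] []
  | leaf {k s w} : Decodes k s w → Decodes (k + 1) s (false :: w)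
  | internal {k n s w} : 0 < n → Decodes (k + n) s w → Decodes (k + 1) (n :: s) (true :: w)

namespace Decodes

theorem of_forest (w : List Bool) : ∀ F : List PTree, F.flatMap PTree.word = w →
    Decodes F.length (F.flatMap PTree.signature) w := by
  induction w with
  | nil =>
    intro F hF
    rcases F with _ | ⟨⟨ts⟩, F⟩
    · exact nil
    · simp [PTree.word_node] at hF
  | cons b w ih =>
    intro F hF
    rcases F with _ | ⟨⟨ts⟩, F⟩
    · simp at hF
    simp only [List.flatMap_cons, PTree.word_node, List.cons_append, List.cons.injEq] at hF
    obtain ⟨rfl, hw⟩ := hF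
    have key := ih (ts ++ F) (by simpa using hw)
    by_cases hts : ts = []
    · subst hts
      simpa [PTree.signature_leaf] using leaf key
    · have hpos := List.length_pos_iff.2 hts
      have he := List.isEmpty_eq_false_iff.2 hts
      rw [List.length_append, add_comm, List.flatMap_append] at key
      simpa [PTree.signature_node_of_ne_nil hts, he] using internal hpos key

theorem exists_forest {k : ℕ} {s : List ℕ} {w : List Bool} (h : Decodes k s w) :
    ∃ F : List PTree, F.length = k ∧ F.flatMap PTree.signature = s ∧
      F.flatMap PTree.word = w := by
  induction h with
  | nil => exact ⟨[], rfl, rfl, rfl⟩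
  | leaf _ ih =>
    obtain ⟨F, rfl, rfl, rfl⟩ := ih
    exact ⟨.node [] :: F, rfl, by simp [PTree.signature_leaf], by simp [PTree.word_node]⟩
  | @internal k n s w hn _ ih =>
    obtain ⟨F, hk, rfl, rfl⟩ := ih
    have hlen : (F.take n).length = n := by simp; omega
    have hne : F.take n ≠ [] := List.length_pos_iff.1 (by omega)
    refine ⟨.node (F.take n) :: F.drop n, by simp; omega, ?_, ?_⟩
    · rw [List.flatMap_cons, PTree.signature_node_of_ne_nil hne, hlen, List.cons_append,
        ← List.flatMap_append, List.take_append_drop]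
    · rw [List.flatMap_cons, PTree.word_node, List.cons_append,
        ← List.flatMap_append, List.take_append_drop, List.isEmpty_eq_false_iff.2 hne]
      rfl

theorem nil_iff {k : ℕ} {s : List ℕ} : Decodes k s [] ↔ k = 0 ∧ s = [] := by
  refine ⟨fun h => ?_, ?_⟩
  · cases h
    exact ⟨rfl, rfl⟩
  · rintro ⟨rfl, rfl⟩
    exact nil

theorem zero_iff {s : List ℕ} {w : List Bool} : Decodes 0 s w ↔ s = [] ∧ w = [] := by
  refine ⟨fun h => ?_, ?_⟩
  · cases h
    exact ⟨rfl, rfl⟩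
  · rintro ⟨rfl, rfl⟩
    exact nil

theorem leaf_iff {k : ℕ} {s : List ℕ} {w : List Bool} :
    Decodes (k + 1) s (false :: w) ↔ Decodes k s w := by
  refine ⟨fun h => ?_, leaf⟩
  cases h
  assumption

theorem internal_iff {k n : ℕ} {s : List ℕ} {w : List Bool} :
    Decodes (k + 1) (n :: s) (true :: w) ↔ 0 < n ∧ Decodes (k + n) s w := by
  refine ⟨fun h => ?_, fun h => internal h.1 h.2⟩
  cases h
  exact ⟨by assumption, by assumption⟩

theorem replicate_iff {s : List ℕ} {w : List Bool} (m : ℕ) : ∀ k : ℕ,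
    Decodes k s (List.replicate m false ++ w) ↔ m ≤ k ∧ Decodes (k - m) s w := by
  induction m with
  | zero => simp
  | succ m ih =>
    rintro (_ | k)
    · simp [zero_iff, List.replicate_succ]
    · simp [List.replicate_succ, leaf_iff, ih]

end Decodes

theorem pathWord_nil : pathWord [] = [false] := rfl

theorem pathWord_cons (m : ℕ) (μ : List ℕ) :
    pathWord (m :: μ) = true :: (List.replicate m false ++ pathWord μ) := by
  simp [pathWord]

theorem pathWord_ne_nil (μ : List ℕ) : pathWord μ ≠ [] := by
  simp [pathWord]

theorem pathWord_ne_false_cons {μ : List ℕ} {w : List Bool} (hw : w ≠ []) :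
    pathWord μ ≠ false :: w := by
  cases μ with
  | nil => simpa [pathWord_nil] using hw.symm
  | cons m μ => simp [pathWord_cons]

theorem replicate_append_pathWord_inj {m n : ℕ} {μ ν : List ℕ}
    (h : List.replicate m false ++ pathWord μ = List.replicate n false ++ pathWord ν) :
    m = n ∧ pathWord μ = pathWord ν := by
  induction m generalizing n with
  | zero =>
    cases n with
    | zero => simpa using h
    | succ n =>
      exact absurd h (by
        simpa [List.replicate_succ] using
          pathWord_ne_false_cons (by simp [pathWord_ne_nil]))
  | succ m ih =>
    cases n with
    | zero =>
      exact absurd h.symm (by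
        simpa [List.replicate_succ] using
          pathWord_ne_false_cons (by simp [pathWord_ne_nil]))
    | succ n =>
      simp only [List.replicate_succ, List.cons_append, List.cons.injEq, true_and] at h
      simpa using ih h

theorem pathWord_injective : Function.Injective pathWord := by
  intro μ
  induction μ with
  | nil =>
    rintro (_ | ⟨n, ν⟩) h
    · rfl
    · simp [pathWord_nil, pathWord_cons] at h
  | cons m μ ih =>
    rintro (_ | ⟨n, ν⟩) h
    · simp [pathWord_nil, pathWord_cons] at h
    · simp only [pathWord_cons, List.cons.injEq, true_and] at h
      obtain ⟨rfl, hμ⟩ := replicate_append_pathWord_inj h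
      rw [ih hμ]

theorem Decodes.exists_replicate_pathWord {w : List Bool} : ∀ {k : ℕ} {s : List ℕ},
    Decodes (k + 1) s w → ∃ m μ, w = List.replicate m false ++ pathWord μ := by
  induction w with
  | nil => simp [Decodes.nil_iff]
  | cons b w ih =>
    intro k s h
    cases h with
    | leaf h =>
      rcases k with _ | k
      · obtain ⟨-, rfl⟩ := Decodes.zero_iff.1 h
        exact ⟨0, [], rfl⟩
      · obtain ⟨m, μ, rfl⟩ := ih h
        exact ⟨m + 1, μ, rfl⟩
    | @internal _ n s _ hn h =>
      obtain ⟨n, rfl⟩ := Nat.exists_eq_add_of_le' hn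
      obtain ⟨m, μ, rfl⟩ := ih h
      exact ⟨0, m :: μ, (pathWord_cons m μ).symm⟩

theorem Decodes.exists_pathWord {s : List ℕ} {w : List Bool} (h : Decodes 1 s w) :
    ∃ μ, w = pathWord μ := by
  obtain ⟨m, μ, rfl⟩ := h.exists_replicate_pathWord
  obtain ⟨hm, h⟩ := (Decodes.replicate_iff m 1).1 h
  rcases Nat.le_one_iff_eq_zero_or_eq_one.1 hm with rfl | rfl
  · exact ⟨μ, rfl⟩
  · exact absurd (Decodes.zero_iff.1 h).2 (pathWord_ne_nil μ)

/-- A variant of `IsDyck` for paths starting `j` steps away from the boundary. -/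
def IsShiftedDyck (j : ℕ) (s μ : List ℕ) : Prop :=
  μ.length = s.length ∧ μ.sum + s.length = s.sum + j ∧
    ∀ i ≤ s.length, (μ.take i).sum ≤ j + ((s.take i).map (fun x => x - 1)).sum

theorem isShiftedDyck_cons {j n m : ℕ} {s μ : List ℕ} (hn : 0 < n) :
    IsShiftedDyck j (n :: s) (m :: μ) ↔
      m ≤ j + (n - 1) ∧ IsShiftedDyck (j + (n - 1) - m) s μ := by
  simp only [IsShiftedDyck, List.length_cons, List.sum_cons]
  constructor
  · rintro ⟨hl, hs, hb⟩
    have hm : m ≤ j + (n - 1) := by simpa using hb 1 (by omega)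
    refine ⟨hm, by omega, by omega, fun i hi => ?_⟩
    have := hb (i + 1) (by omega)
    simp only [List.take_succ_cons, List.sum_cons, List.map_cons] at this
    omega
  · rintro ⟨hm, hl, hs, hb⟩
    refine ⟨by omega, by omega, ?_⟩
    rintro (_ | i) hi
    · simp
    · have := hb i (by omega)
      simp only [List.take_succ_cons, List.sum_cons, List.map_cons]
      omega

theorem decodes_pathWord_iff {s : List ℕ} (hs : ∀ x ∈ s, 0 < x) : ∀ (j : ℕ) (μ : List ℕ),
    Decodes (j + 1) s (pathWord μ) ↔ IsShiftedDyck j s μ := by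
  induction s with
  | nil =>
    rintro j (_ | ⟨m, μ⟩)
    · simp [pathWord_nil, Decodes.leaf_iff, Decodes.nil_iff, IsShiftedDyck, eq_comm]
    · refine iff_of_false (fun h => ?_) (by simp [IsShiftedDyck])
      rw [pathWord_cons] at h
      cases h
  | cons n s ih =>
    have hn : 0 < n := hs n (by simp)
    rintro j (_ | ⟨m, μ⟩)
    · simp [pathWord_nil, Decodes.leaf_iff, Decodes.nil_iff, IsShiftedDyck]
    · rw [pathWord_cons, Decodes.internal_iff, Decodes.replicate_iff, isShiftedDyck_cons hn]
      by_cases hm : m ≤ j + (n - 1)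
      · rw [← ih (fun x hx => hs x (by simp [hx])),
          show j + n - m = j + (n - 1) - m + 1 by omega]
        simp only [hn, hm, true_and, and_iff_right_iff_imp]
        omega
      · refine iff_of_false ?_ (fun h => hm h.1)
        rintro ⟨-, hle, h⟩
        rw [show j + n - m = 0 by omega, Decodes.zero_iff] at h
        exact pathWord_ne_nil μ h.2

theorem decodes_one_pathWord_iff {s : List ℕ} (hs : ∀ x ∈ s, 0 < x) (μ : List ℕ) :
    Decodes 1 s (pathWord μ) ↔ IsDyck s μ := by
  simpa [IsShiftedDyck, IsDyck] using decodes_pathWord_iff hs 0 μ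

/-- For every composition `s`, the map sending an `s`-tree `T` to the sequence `μ` with
preorder word of `T` equal to `N E^{μ(1)} ⋯ N E^{μ(a)} E` is a bijection from `s`-trees
onto `s`-Dyck paths. -/
theorem sTrees_equiv_sDyckPaths (s : List ℕ) (hs : ∀ x ∈ s, 0 < x) :
    ∃ f : {T : PTree // T.signature = s} → {μ : List ℕ // IsDyck s μ},
      (∀ T : {T : PTree // T.signature = s}, T.1.word = pathWord (f T).1) ∧
      Function.Bijective f := by
  have hex : ∀ T : {T : PTree // T.signature = s},
      ∃ μ : {μ : List ℕ // IsDyck s μ}, T.1.word = pathWord μ.1 := by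
    rintro ⟨T, rfl⟩
    have h : Decodes 1 T.signature T.word := by simpa using Decodes.of_forest _ [T] rfl
    obtain ⟨μ, hμ⟩ := h.exists_pathWord
    exact ⟨⟨μ, (decodes_one_pathWord_iff hs μ).1 (hμ ▸ h)⟩, hμ⟩
  choose f hf using hex
  refine ⟨f, hf, fun T U hTU => ?_, fun μ => ?_⟩
  · have hw : U.1.word = T.1.word := by rw [hf, hf, hTU]
    have := PTree.forest_ext T.1.word [T.1] [U.1] (by simp) (by simp [hw]) (by simp [T.2, U.2])
    exact Subtype.ext (by simpa using this)
  · obtain ⟨F, hl, hsig, hw⟩ := ((decodes_one_pathWord_iff hs μ.1).2 μ.2).exists_forest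
    obtain ⟨T, rfl⟩ := List.length_eq_one_iff.1 hl
    refine ⟨⟨T, by simpa using hsig⟩, Subtype.ext (pathWord_injective ?_)⟩
    rw [← hf]
    simpa using hw
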